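/- Let p be an odd prime, 2 ≤ n ≤ p, and set l = n/2 if n is even, l = (n−1)/2 if n is odd. Then the Hilbert series of I_{n−1}^G = k[V_3]^G ∩ im(Δ^{n−1}) satisfies (1−t)(1−t^2)(1−t^p)·H(I_{n−1}^G, t) = t^l + t^{p−l}. -/

import Mathlib

open MvPolynomial

/-- The algebra automorphism `σ` of `k[V_m] = k[x_1,…,x_m]` given by
`σ x_i = x_i + x_{i+1}` for `i < m` and `σ x_m = x_m` (0-indexed). -/
noncomputable def sigmaHom (k : Type*) [CommRing k] (m : ℕ) :
    MvPolynomial (Fin m) k →ₐ[k] MvPolynomial (Fin m) k :=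
  aeval (fun i : Fin m =>
    X i + if h : (i : ℕ) + 1 < m then X (⟨(i : ℕ) + 1, h⟩ : Fin m) else 0)

/-- The twisted derivation `Δ = σ - 1` as a `k`-linear endomorphism of `k[V_m]`. -/
noncomputable def delta (k : Type*) [CommRing k] (m : ℕ) :
    Module.End k (MvPolynomial (Fin m) k) :=
  (sigmaHom k m).toLinearMap - LinearMap.id

section Sigma

variable {k : Type*} [Field k]

lemma sigmaHom_X_zero : sigmaHom k 3 (X 0) = X 0 + X 1 := by
  simp [sigmaHom]

lemma sigmaHom_X_one : sigmaHom k 3 (X 1) = X 1 + X 2 := by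
  simp [sigmaHom]

lemma sigmaHom_X_two : sigmaHom k 3 (X 2) = X 2 := by
  simp [sigmaHom]

lemma delta_apply (m : ℕ) (f : MvPolynomial (Fin m) k) :
    delta k m f = sigmaHom k m f - f := rfl

lemma mem_ker_delta {m : ℕ} {f : MvPolynomial (Fin m) k} :
    f ∈ LinearMap.ker (delta k m) ↔ sigmaHom k m f = f := by
  rw [LinearMap.mem_ker, delta_apply, sub_eq_zero]

lemma toLinearMap_pow_apply {m : ℕ} (i : ℕ) (f : MvPolynomial (Fin m) k) :
    ((sigmaHom k m).toLinearMap ^ i) f = (sigmaHom k m ^ i) f := by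
  induction i generalizing f with
  | zero => rfl
  | succ i ih => rw [pow_succ, pow_succ, Module.End.mul_apply, ih]; rfl

lemma sigmaHom_pow_succ_apply {m : ℕ} (i : ℕ) (f : MvPolynomial (Fin m) k) :
    (sigmaHom k m ^ (i + 1)) f = sigmaHom k m ((sigmaHom k m ^ i) f) := by
  rw [pow_succ']; rfl

lemma sigmaHom_pow_X_two (i : ℕ) : (sigmaHom k 3 ^ i) (X 2) = X 2 := by
  induction i with
  | zero => simp
  | succ i ih => rw [sigmaHom_pow_succ_apply, ih, sigmaHom_X_two]

lemma sigmaHom_pow_X_one (i : ℕ) :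
    (sigmaHom k 3 ^ i) (X 1) = X 1 + (i : MvPolynomial _ k) * X 2 := by
  induction i with
  | zero => simp
  | succ i ih =>
    rw [sigmaHom_pow_succ_apply, ih]
    simp only [map_add, map_mul, map_natCast, sigmaHom_X_one, sigmaHom_X_two]
    push_cast; ring

lemma two_mul_sigmaHom_pow_X_zero (i : ℕ) :
    (sigmaHom k 3 ^ i) (2 * X 0) =
      2 * X 0 + (i : MvPolynomial _ k) * (2 * X 1 - X 2) + (i : MvPolynomial _ k) ^ 2 * X 2 := by
  induction i with
  | zero => simp
  | succ i ih =>
    rw [sigmaHom_pow_succ_apply, ih]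
    simp only [map_add, map_sub, map_pow, map_mul, map_natCast, map_ofNat,
      sigmaHom_X_zero, sigmaHom_X_one, sigmaHom_X_two]
    push_cast; ring

lemma sigmaHom_pow_prime {p : ℕ} (hp : p.Prime) (hodd : Odd p) [CharP k p] :
    sigmaHom k 3 ^ p = 1 := by
  have hp0 : (p : MvPolynomial (Fin 3) k) = 0 := CharP.cast_eq_zero _ p
  have h2 : (2 : MvPolynomial (Fin 3) k) ≠ 0 := by
    have : ((2 : ℕ) : MvPolynomial (Fin 3) k) ≠ 0 := by
      rw [Ne, CharP.cast_eq_zero_iff _ p, Nat.prime_dvd_prime_iff_eq hp Nat.prime_two]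
      rintro rfl
      exact absurd hodd (by decide)
    exact_mod_cast this
  refine MvPolynomial.algHom_ext fun i => ?_
  fin_cases i
  · refine mul_left_cancel₀ h2 ?_
    have := two_mul_sigmaHom_pow_X_zero (k := k) p
    rw [map_mul, map_ofNat, hp0, zero_mul, add_zero, zero_pow two_ne_zero, zero_mul,
      add_zero] at this
    exact this
  · simpa [hp0] using sigmaHom_pow_X_one (k := k) p
  · simpa using sigmaHom_pow_X_two (k := k) p

lemma delta_pow_mul_of_invariant {m : ℕ} {g : MvPolynomial (Fin m) k}
    (hg : sigmaHom k m g = g) (j : ℕ) (f : MvPolynomial (Fin m) k) :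
    (delta k m ^ j) (g * f) = g * (delta k m ^ j) f := by
  induction j generalizing f with
  | zero => rfl
  | succ j ih =>
    rw [pow_succ, Module.End.mul_apply, Module.End.mul_apply, ← ih]
    simp only [delta_apply, map_mul, hg, mul_sub]

lemma range_delta_pow_anti {m : ℕ} {i j : ℕ} (h : i ≤ j) :
    LinearMap.range (delta k m ^ j) ≤ LinearMap.range (delta k m ^ i) := by
  rintro _ ⟨f, rfl⟩
  obtain ⟨c, rfl⟩ := Nat.exists_eq_add_of_le h
  exact ⟨(delta k m ^ c) f, by rw [pow_add, Module.End.mul_apply]⟩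

lemma mul_mem_range_delta_pow {m j : ℕ} {f g : MvPolynomial (Fin m) k}
    (hg : sigmaHom k m g = g) (hf : f ∈ LinearMap.range (delta k m ^ j)) :
    g * f ∈ LinearMap.range (delta k m ^ j) := by
  obtain ⟨f, rfl⟩ := hf
  exact ⟨g * f, delta_pow_mul_of_invariant hg j f⟩

lemma sub_one_pow_prime_sub_one {p : ℕ} (hp : p.Prime) {A : Type*} [Ring A] [Algebra k A]
    [CharP k p] (a : A) : (a - 1) ^ (p - 1) = ∑ i ∈ Finset.range p, a ^ i := by
  have := Fact.mk hp
  have key : (Polynomial.X - 1 : Polynomial k) ^ (p - 1) =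
      ∑ i ∈ Finset.range p, Polynomial.X ^ i := by
    have hne : (Polynomial.X - 1 : Polynomial k) ≠ 0 := by
      simpa using Polynomial.X_sub_C_ne_zero (1 : k)
    refine mul_right_cancel₀ hne ?_
    rw [geom_sum_mul, ← pow_succ, Nat.sub_add_cancel hp.one_le, sub_pow_char, one_pow]
  simpa using congrArg (Polynomial.aeval a) key

lemma delta_eq (m : ℕ) : delta k m = (sigmaHom k m).toLinearMap - 1 := rfl

lemma delta_pow_prime_sub_one {p : ℕ} (hp : p.Prime) [CharP k p] {m : ℕ}
    (f : MvPolynomial (Fin m) k) :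
    (delta k m ^ (p - 1)) f = ∑ i ∈ Finset.range p, (sigmaHom k m ^ i) f := by
  rw [delta_eq, sub_one_pow_prime_sub_one (k := k) hp, LinearMap.sum_apply]
  exact Finset.sum_congr rfl fun i _ => toLinearMap_pow_apply i f

lemma delta_pow_prime {p : ℕ} (hp : p.Prime) (hodd : Odd p) [CharP k p] :
    delta k 3 ^ p = 0 := by
  have h : delta k 3 ^ p = (∑ i ∈ Finset.range p, (sigmaHom k 3).toLinearMap ^ i) * delta k 3 := by
    rw [← sub_one_pow_prime_sub_one (k := k) hp, ← delta_eq, ← pow_succ,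
      Nat.sub_add_cancel hp.one_le]
  rw [h, delta_eq, geom_sum_mul, sub_eq_zero]
  refine LinearMap.ext fun f => ?_
  rw [toLinearMap_pow_apply, sigmaHom_pow_prime hp hodd]
  rfl

lemma isHomogeneous_sigmaHom {m d : ℕ} {f : MvPolynomial (Fin m) k} (hf : f.IsHomogeneous d) :
    (sigmaHom k m f).IsHomogeneous d := by
  have := hf.aeval (fun i : Fin m => X (R := k) i +
    if h : (i : ℕ) + 1 < m then X (⟨(i : ℕ) + 1, h⟩ : Fin m) else 0) (n := 1) ?_
  · simpa [sigmaHom] using this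
  · intro i
    refine (isHomogeneous_X k i).add ?_
    split_ifs
    · exact isHomogeneous_X k _
    · exact isHomogeneous_zero _ _ _

lemma isHomogeneous_sigmaHom_pow {m d : ℕ} {f : MvPolynomial (Fin m) k} (hf : f.IsHomogeneous d)
    (i : ℕ) : ((sigmaHom k m ^ i) f).IsHomogeneous d := by
  induction i with
  | zero => simpa
  | succ i ih => rw [sigmaHom_pow_succ_apply]; exact isHomogeneous_sigmaHom ih

lemma isHomogeneous_delta {m d : ℕ} {f : MvPolynomial (Fin m) k} (hf : f.IsHomogeneous d) :
    (delta k m f).IsHomogeneous d :=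
  (isHomogeneous_sigmaHom hf).sub hf

lemma homogeneousComponent_delta {m : ℕ} (d : ℕ) (f : MvPolynomial (Fin m) k) :
    homogeneousComponent d (delta k m f) = delta k m (homogeneousComponent d f) := by
  conv_lhs => rw [← sum_homogeneousComponent f, map_sum, map_sum]
  have h : ∀ i, homogeneousComponent d (delta k m (homogeneousComponent i f)) =
      if d = i then delta k m (homogeneousComponent i f) else 0 := fun i => by
    rw [homogeneousComponent_of_mem (isHomogeneous_delta (homogeneousComponent_isHomogeneous i f))]
  simp only [h, Finset.sum_ite_eq, Finset.mem_range]
  split_ifs with hd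
  · rfl
  · rw [homogeneousComponent_eq_zero _ _ (by omega), map_zero]

lemma homogeneousComponent_delta_pow {m : ℕ} (d j : ℕ) (f : MvPolynomial (Fin m) k) :
    homogeneousComponent d ((delta k m ^ j) f) = (delta k m ^ j) (homogeneousComponent d f) := by
  induction j generalizing f with
  | zero => rfl
  | succ j ih => rw [pow_succ, Module.End.mul_apply, Module.End.mul_apply, ih,
      homogeneousComponent_delta]

instance finite_homogeneousSubmodule (m d : ℕ) :
    Module.Finite k (homogeneousSubmodule (Fin m) k d) :=
  Module.Finite.of_fg (homogeneousSubmodule_fg _ k d)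

/-- `Δ` maps the degree-`d` part of `im Δ^j` onto that of `im Δ^(j+1)`. -/
lemma finrank_range_delta_pow (m j d : ℕ) :
    Module.finrank k ↥(LinearMap.range (delta k m ^ j) ⊓ homogeneousSubmodule (Fin m) k d) =
      Module.finrank k ↥(LinearMap.range (delta k m ^ (j + 1)) ⊓
        homogeneousSubmodule (Fin m) k d) +
      Module.finrank k ↥(LinearMap.range (delta k m ^ j) ⊓ LinearMap.ker (delta k m) ⊓
        homogeneousSubmodule (Fin m) k d) := by
  set W := LinearMap.range (delta k m ^ j) ⊓ homogeneousSubmodule (Fin m) k d with hW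
  have : Module.Finite k W := Submodule.finiteDimensional_of_le (inf_le_right)
  have h := LinearMap.finrank_range_add_finrank_ker ((delta k m).domRestrict W)
  rw [← h]
  congr 1
  · have : LinearMap.range (delta k m ^ (j + 1)) ⊓ homogeneousSubmodule (Fin m) k d =
        LinearMap.range ((delta k m).domRestrict W) := ?_
    · rw [this]
    rw [LinearMap.range_domRestrict]
    symm
    ext f
    constructor
    · rintro ⟨_, ⟨⟨g, rfl⟩, hg⟩, rfl⟩
      exact ⟨⟨g, by rw [pow_succ', Module.End.mul_apply]⟩, isHomogeneous_delta hg⟩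
    · rintro ⟨⟨g, rfl⟩, hg⟩
      refine ⟨(delta k m ^ j) (homogeneousComponent d g), ⟨⟨_, rfl⟩, ?_⟩, ?_⟩
      · rw [← homogeneousComponent_delta_pow]
        exact homogeneousComponent_isHomogeneous _ _
      · rw [← Module.End.mul_apply, ← pow_succ', ← homogeneousComponent_delta_pow]
        exact homogeneousComponent_eq_self hg
  · have : LinearMap.range (delta k m ^ j) ⊓ LinearMap.ker (delta k m) ⊓
        homogeneousSubmodule (Fin m) k d =
        (LinearMap.ker ((delta k m).domRestrict W)).map W.subtype := by
      ext f
      simp only [Submodule.mem_inf, Submodule.mem_map, LinearMap.mem_ker]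
      constructor
      · rintro ⟨⟨h1, h2⟩, h3⟩
        exact ⟨⟨f, h1, h3⟩, h2, rfl⟩
      · rintro ⟨⟨g, h1, h3⟩, h2, rfl⟩
        exact ⟨⟨h1, h2⟩, h3⟩
    rw [this]
    exact LinearEquiv.finrank_eq
      (Submodule.equivMapOfInjective W.subtype W.injective_subtype _)

lemma sum_finrank_invariants {p : ℕ} (hp : p.Prime) (hodd : Odd p) [CharP k p] (d : ℕ) :
    ∑ j ∈ Finset.range p,
      Module.finrank k ↥(LinearMap.range (delta k 3 ^ j) ⊓ LinearMap.ker (delta k 3) ⊓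
        homogeneousSubmodule (Fin 3) k d) =
    Module.finrank k (homogeneousSubmodule (Fin 3) k d) := by
  have h : ∀ q : ℕ, Module.finrank k ↥(LinearMap.range (delta k 3 ^ q) ⊓
      homogeneousSubmodule (Fin 3) k d) + ∑ j ∈ Finset.range q,
      Module.finrank k ↥(LinearMap.range (delta k 3 ^ j) ⊓ LinearMap.ker (delta k 3) ⊓
        homogeneousSubmodule (Fin 3) k d) =
      Module.finrank k (homogeneousSubmodule (Fin 3) k d) := by
    intro q
    induction q with
    | zero =>
      have : LinearMap.range (delta k 3 ^ 0) = ⊤ := by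
        rw [pow_zero]; exact LinearMap.range_id
      rw [this, top_inf_eq, Finset.sum_range_zero, add_zero]
    | succ q ih => rw [Finset.sum_range_succ, ← ih, finrank_range_delta_pow 3 q d]; ring
  have := h p
  rw [delta_pow_prime hp hodd, LinearMap.range_zero, bot_inf_eq, finrank_bot, zero_add] at this
  exact this

end Sigma

section PowerSums

variable {p : ℕ} {A : Type*} [CommRing A] [CharP A p]

lemma ZMod.sum_pow_le_two_mul (hp : p.Prime) {m : ℕ} (hm : m ≤ 2 * (p - 1)) :
    ∑ x ∈ Finset.range p, (x : ZMod p) ^ m = if m = p - 1 ∨ m = 2 * (p - 1) then -1 else 0 := by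
  have := Fact.mk hp
  have h2 := hp.two_le
  have hrange : ∑ x ∈ Finset.range p, (x : ZMod p) ^ m = ∑ x : ZMod p, x ^ m :=
    Finset.sum_bij' (fun x _ => (x : ZMod p)) (fun x _ => x.val) (fun _ _ => Finset.mem_univ _)
      (fun x _ => Finset.mem_range.2 (ZMod.val_lt x))
      (fun x hx => ZMod.val_cast_of_lt (Finset.mem_range.1 hx))
      (fun x _ => ZMod.natCast_zmod_val x) (fun _ _ => rfl)
  have hcard : ∑ x : ZMod p, x ^ (p - 1) = -1 := by
    simp_rw [ZMod.pow_card_sub_one]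
    rw [Finset.sum_boole, Finset.filter_ne', Finset.card_erase_of_mem (Finset.mem_univ _),
      Finset.card_univ, ZMod.card, Nat.cast_sub hp.one_le]
    simp
  have hlt : ∀ r < p - 1, ∑ x : ZMod p, x ^ r = 0 := fun r hr =>
    FiniteField.sum_pow_lt_card_sub_one _ r (by rwa [ZMod.card])
  rw [hrange]
  rcases lt_trichotomy m (p - 1) with h | h | h
  · rw [if_neg (by omega), hlt m h]
  · rw [if_pos (Or.inl h), h, hcard]
  · obtain ⟨r, rfl⟩ := Nat.exists_eq_add_of_lt h
    have hred : ∑ x : ZMod p, x ^ (p - 1 + r + 1) = ∑ x : ZMod p, x ^ (r + 1) := by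
      refine Finset.sum_congr rfl fun x _ => ?_
      rw [show p - 1 + r + 1 = p + r by omega, pow_add, ZMod.pow_card, pow_succ']
    rw [hred]
    rcases (show r + 1 ≤ p - 1 by omega).lt_or_eq with hr | hr
    · rw [if_neg (by omega), hlt _ hr]
    · rw [if_pos (by omega), hr, hcard]

lemma Polynomial.sum_eval_natCast (hp : p.Prime) {F : Polynomial A}
    (hF : F.natDegree ≤ 2 * (p - 1)) :
    ∑ i ∈ Finset.range p, F.eval (i : A) = -(F.coeff (p - 1) + F.coeff (2 * (p - 1))) := by
  have h2 := hp.two_le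
  have hpow : ∀ m ∈ Finset.range (2 * (p - 1) + 1), ∑ i ∈ Finset.range p, F.coeff m * (i : A) ^ m =
      -((if m = p - 1 then F.coeff m else 0) + if m = 2 * (p - 1) then F.coeff m else 0) := by
    intro m hm
    have h := congrArg (ZMod.castHom dvd_rfl A)
      (ZMod.sum_pow_le_two_mul hp (Nat.lt_succ_iff.1 (Finset.mem_range.1 hm)))
    simp only [map_sum, map_pow, map_natCast] at h
    rw [← Finset.mul_sum, h]
    by_cases h1 : m = p - 1
    · have : m ≠ 2 * (p - 1) := by omega
      simp [h1]; omega
    · by_cases h3 : m = 2 * (p - 1) <;> simp [h1, h3]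
      omega
  simp_rw [Polynomial.eval_eq_sum_range' (Nat.lt_succ_of_le hF)]
  rw [Finset.sum_comm, Finset.sum_congr rfl hpow, Finset.sum_neg_distrib, Finset.sum_add_distrib,
    Finset.sum_ite_eq', Finset.sum_ite_eq', if_pos, if_pos]
  all_goals simp; try omega

end PowerSums

section Orbit

variable {k : Type*} [Field k]

/-- The quadratic polynomial over `k[V_3]` whose value at `i` is `σ^i (2 x_1)`. -/
noncomputable def orbitPoly (k : Type*) [Field k] : Polynomial (MvPolynomial (Fin 3) k) :=
  Polynomial.C (X 2) * Polynomial.X ^ 2 + Polynomial.C (2 * X 1 - X 2) * Polynomial.X +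
    Polynomial.C (2 * X 0)

/-- The discriminant of `orbitPoly`, a quadratic invariant. -/
noncomputable def disc (k : Type*) [Field k] : MvPolynomial (Fin 3) k :=
  (2 * X 1 - X 2) ^ 2 - 8 * X 0 * X 2

lemma eval_orbitPoly (i : ℕ) :
    (orbitPoly k).eval (i : MvPolynomial (Fin 3) k) = (sigmaHom k 3 ^ i) (2 * X 0) := by
  rw [two_mul_sigmaHom_pow_X_zero]
  simp [orbitPoly]
  ring

lemma natDegree_orbitPoly : (orbitPoly k).natDegree = 2 :=
  Polynomial.natDegree_quadratic (X_ne_zero 2)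

lemma leadingCoeff_orbitPoly : (orbitPoly k).leadingCoeff = X 2 :=
  Polynomial.leadingCoeff_quadratic (X_ne_zero 2)

lemma natDegree_orbitPoly_pow (e : ℕ) : (orbitPoly k ^ e).natDegree = 2 * e := by
  rw [Polynomial.natDegree_pow, natDegree_orbitPoly, mul_comm]

lemma derivative_orbitPoly : Polynomial.derivative (orbitPoly k) =
    2 * Polynomial.C (X 2) * Polynomial.X + Polynomial.C (2 * X 1 - X 2) := by
  simp only [orbitPoly, Polynomial.derivative_add,
    Polynomial.derivative_C_mul, Polynomial.derivative_X, Polynomial.derivative_C, map_mul]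
  simp
  ring

lemma derivative_orbitPoly_sq : Polynomial.derivative (orbitPoly k) ^ 2 =
    Polynomial.C (disc k) + 4 * Polynomial.C (X 2) * orbitPoly k := by
  rw [derivative_orbitPoly, orbitPoly, disc]
  simp only [map_sub, map_mul, map_pow, map_ofNat]
  ring

lemma derivative_derivative_orbitPoly :
    Polynomial.derivative (Polynomial.derivative (orbitPoly k)) = 2 * Polynomial.C (X 2) := by
  rw [derivative_orbitPoly]
  simp [Polynomial.derivative_mul]

lemma sigmaHom_disc : sigmaHom k 3 (disc k) = disc k := by
  simp only [disc, map_sub, map_mul, map_pow, map_ofNat, sigmaHom_X_zero, sigmaHom_X_one,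
    sigmaHom_X_two]
  ring

lemma sigmaHom_pow_delta_pow {m : ℕ} {f : MvPolynomial (Fin m) k}
    {P : Polynomial (MvPolynomial (Fin m) k)}
    (h : ∀ i : ℕ, (sigmaHom k m ^ i) f = P.eval (i : MvPolynomial (Fin m) k)) (j i : ℕ) :
    (sigmaHom k m ^ i) ((delta k m ^ j) f) =
      (fwdDiff 1)^[j] P.eval (i : MvPolynomial (Fin m) k) := by
  induction j generalizing i with
  | zero => exact h i
  | succ j ih =>
    rw [Function.iterate_succ_apply', fwdDiff, ← ih, pow_succ', Module.End.mul_apply, delta_apply,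
      map_sub, ← Nat.cast_succ, ← ih, pow_succ]
    rfl

lemma X_two_pow_mem_range {p : ℕ} (hp : p.Prime) [CharP k p] {a : ℕ} (ha : 2 * a < p) :
    (X 2 : MvPolynomial (Fin 3) k) ^ a ∈ LinearMap.range (delta k 3 ^ (2 * a)) := by
  have h := sigmaHom_pow_delta_pow (f := (2 * X 0 : MvPolynomial (Fin 3) k) ^ a)
    (P := orbitPoly k ^ a) (fun i => by
      rw [map_pow, Polynomial.eval_pow, eval_orbitPoly]) (2 * a) 0
  have hne : ((2 * a).factorial : k) ≠ 0 := by
    rw [Ne, CharP.cast_eq_zero_iff k p, hp.dvd_factorial]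
    omega
  have h3 := (orbitPoly k ^ a).fwdDiff_iter_degree_eq_factorial
  rw [natDegree_orbitPoly_pow, Polynomial.leadingCoeff_pow, leadingCoeff_orbitPoly] at h3
  rw [h3] at h
  refine ⟨((2 * a).factorial : k)⁻¹ • (2 * X 0) ^ a, ?_⟩
  rw [map_smul, inv_smul_eq_iff₀ hne]
  refine h.trans ?_
  simp [Algebra.smul_def, mul_comm]

/-- The traces `∑ σ^i ((2 x_1)^e)`. -/
lemma delta_pow_two_mul_X_zero_pow {p : ℕ} (hp : p.Prime) [CharP k p] (e : ℕ) :
    (delta k 3 ^ (p - 1)) ((2 * X 0) ^ e) =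
      ∑ i ∈ Finset.range p, (orbitPoly k ^ e).eval (i : MvPolynomial (Fin 3) k) := by
  rw [delta_pow_prime_sub_one hp]
  exact Finset.sum_congr rfl fun i _ => by rw [map_pow, Polynomial.eval_pow, eval_orbitPoly]

/-- The three-term recursion for the traces, obtained by summing a derivative over `𝔽_p`. -/
lemma trace_recursion {p : ℕ} (hp : p.Prime) [CharP k p] {e : ℕ} (he : e + 1 ≤ p - 1) :
    ((e + 1 : ℕ) : MvPolynomial (Fin 3) k) *
        (disc k * (delta k 3 ^ (p - 1)) ((2 * X 0) ^ e)) +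
      ((4 * e + 6 : ℕ) : MvPolynomial (Fin 3) k) *
        (X 2 * (delta k 3 ^ (p - 1)) ((2 * X 0) ^ (e + 1))) =
      if e + 1 = p - 1 then 2 * X 2 ^ p else 0 := by
  have h2 := hp.two_le
  have hp0 : (p : MvPolynomial (Fin 3) k) = 0 := CharP.cast_eq_zero _ p
  set F := orbitPoly k ^ (e + 1) * Polynomial.derivative (orbitPoly k) with hF
  have hder : Polynomial.derivative F =
      ((e + 1 : ℕ) : Polynomial (MvPolynomial (Fin 3) k)) *
          (Polynomial.C (disc k) * orbitPoly k ^ e) +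
        ((4 * e + 6 : ℕ) : Polynomial (MvPolynomial (Fin 3) k)) *
          (Polynomial.C (X 2) * orbitPoly k ^ (e + 1)) := by
    have : Polynomial.derivative F = (e + 1) * orbitPoly k ^ e *
        Polynomial.derivative (orbitPoly k) ^ 2 + orbitPoly k ^ (e + 1) *
        Polynomial.derivative (Polynomial.derivative (orbitPoly k)) := by
      rw [hF, Polynomial.derivative_mul, Polynomial.derivative_pow]
      simp
      ring
    rw [this, derivative_orbitPoly_sq, derivative_derivative_orbitPoly]
    push_cast
    ring
  have hdeg' : (Polynomial.derivative (orbitPoly k)).natDegree ≤ 1 := by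
    have := Polynomial.natDegree_derivative_le (orbitPoly k)
    rwa [natDegree_orbitPoly] at this
  have hdeg : F.natDegree ≤ 2 * (e + 1) + 1 := by
    refine Polynomial.natDegree_mul_le.trans ?_
    rw [natDegree_orbitPoly_pow]
    omega
  have hsum := Polynomial.sum_eval_natCast hp (F := Polynomial.derivative F)
    ((Polynomial.natDegree_derivative_le F).trans (by omega))
  rw [Polynomial.coeff_derivative, Polynomial.coeff_derivative, ← Nat.cast_succ, ← Nat.cast_succ,
    Nat.succ_eq_add_one, Nat.sub_add_cancel hp.one_le, hp0, mul_zero, zero_add] at hsum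
  rw [delta_pow_two_mul_X_zero_pow hp, delta_pow_two_mul_X_zero_pow hp]
  have hlhs : ∑ i ∈ Finset.range p, (Polynomial.derivative F).eval (i : MvPolynomial (Fin 3) k) =
      ((e + 1 : ℕ) : MvPolynomial (Fin 3) k) * (disc k * ∑ i ∈ Finset.range p,
        (orbitPoly k ^ e).eval (i : MvPolynomial (Fin 3) k)) +
      ((4 * e + 6 : ℕ) : MvPolynomial (Fin 3) k) * (X 2 * ∑ i ∈ Finset.range p,
        (orbitPoly k ^ (e + 1)).eval (i : MvPolynomial (Fin 3) k)) := by
    simp only [hder, Finset.mul_sum, ← Finset.sum_add_distrib]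
    refine Finset.sum_congr rfl fun i _ => ?_
    simp only [Polynomial.eval_add, Polynomial.eval_mul, Polynomial.eval_natCast,
      Polynomial.eval_C]
  rw [← hlhs, hsum]
  have hcast : ((2 * (p - 1) + 1 : ℕ) : MvPolynomial (Fin 3) k) = -1 := by
    rw [eq_neg_iff_add_eq_zero, ← Nat.cast_succ, show (2 * (p - 1) + 1).succ = 2 * p by omega]
    simp
  rw [hcast]
  split_ifs with h
  · have hc : F.coeff (2 * (p - 1) + 1) = 2 * X 2 ^ p := by
      rw [hF, h, Polynomial.coeff_mul_add_eq_of_natDegree_le (natDegree_orbitPoly_pow _).le hdeg',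
        ← natDegree_orbitPoly_pow (k := k), Polynomial.coeff_natDegree, Polynomial.leadingCoeff_pow,
        leadingCoeff_orbitPoly, derivative_orbitPoly]
      conv_rhs => rw [← Nat.sub_add_cancel hp.one_le]
      simp [Polynomial.coeff_C, pow_succ]
      ring
    rw [hc]; ring
  · rw [Polynomial.coeff_eq_zero_of_natDegree_lt (by omega)]
    simp

lemma natCast_eq_C (n : ℕ) : ((n : ℕ) : MvPolynomial (Fin 3) k) = C (n : k) := by simp

lemma four_mul_add_six_ne_zero {s : ℕ} (hp : (2 * s + 1).Prime) [CharP k (2 * s + 1)] {b : ℕ}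
    (hb : b + 1 < 2 * s + 1) : ((4 * (s + b) + 6 : ℕ) : k) ≠ 0 := by
  rw [Ne, CharP.cast_eq_zero_iff k (2 * s + 1),
    show 4 * (s + b) + 6 = 2 * (2 * s + 1) + 2 * (2 * (b + 1)) by ring,
    Nat.dvd_add_right (Dvd.intro_left _ rfl), hp.dvd_mul, hp.dvd_mul]
  have h2 : ¬ 2 * s + 1 ∣ 2 := fun h => by
    have := Nat.le_of_dvd two_pos h
    have := hp.two_le
    omega
  have h3 : ¬ 2 * s + 1 ∣ b + 1 := Nat.not_dvd_of_pos_of_lt (by omega) hb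
  tauto

lemma exists_trace_eq {s : ℕ} (hp : (2 * s + 1).Prime) [CharP k (2 * s + 1)] {b : ℕ} (hb : b < s) :
    ∃ u : k, u ≠ 0 ∧ (delta k 3 ^ (2 * s)) ((2 * X 0) ^ (s + b)) =
      C u * (X 2 ^ (s - b) * disc k ^ b) := by
  induction b with
  | zero =>
    refine ⟨-1, by simp, ?_⟩
    have h := Polynomial.sum_eval_natCast hp (F := orbitPoly k ^ s)
      (by rw [natDegree_orbitPoly_pow]; omega)
    have hc : (orbitPoly k ^ s).coeff (2 * s) = X 2 ^ s := by
      rw [← natDegree_orbitPoly_pow (k := k), Polynomial.coeff_natDegree,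
        Polynomial.leadingCoeff_pow, leadingCoeff_orbitPoly]
    have hc' : (orbitPoly k ^ s).coeff (2 * (2 * s)) = 0 :=
      Polynomial.coeff_eq_zero_of_natDegree_lt (by rw [natDegree_orbitPoly_pow]; omega)
    rw [Nat.add_sub_cancel, hc, hc'] at h
    have h' := delta_pow_two_mul_X_zero_pow (k := k) hp s
    rw [Nat.add_sub_cancel] at h'
    rw [add_zero, h', h]
    simp
  | succ b ih =>
    obtain ⟨u, hu, hT⟩ := ih (by omega)
    have hrec := trace_recursion (k := k) hp (e := s + b) (by omega)
    have h1 : ((s + b + 1 : ℕ) : k) ≠ 0 := by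
      rw [Ne, CharP.cast_eq_zero_iff k (2 * s + 1)]
      exact Nat.not_dvd_of_pos_of_lt (by omega) (by omega)
    have h2 := four_mul_add_six_ne_zero (k := k) hp (b := b) (by omega)
    rw [if_neg (by omega), Nat.add_sub_cancel, hT, natCast_eq_C, natCast_eq_C] at hrec
    refine ⟨-((s + b + 1 : ℕ) : k) * u / ((4 * (s + b) + 6 : ℕ) : k),
      div_ne_zero (mul_ne_zero (neg_ne_zero.2 h1) hu) h2, ?_⟩
    refine mul_left_cancel₀ (mul_ne_zero (C_ne_zero.2 h2) (X_ne_zero (2 : Fin 3))) ?_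
    rw [show (s + b + 1) = s + (b + 1) by ring] at hrec
    have hC : C (σ := Fin 3) ((4 * (s + b) + 6 : ℕ) : k) *
        C (-((s + b + 1 : ℕ) : k) * u / ((4 * (s + b) + 6 : ℕ) : k)) =
        -(C ((s + b + 1 : ℕ) : k) * C u) := by
      rw [← C_mul, ← C_mul, mul_div_cancel₀ _ h2, ← C_neg, neg_mul]
    rw [show s - b = s - (b + 1) + 1 by omega] at hrec
    linear_combination hrec - X 2 * (X 2 ^ (s - (b + 1)) * disc k ^ (b + 1)) * hC

lemma X_two_pow_mul_disc_pow_mem {s : ℕ} (hp : (2 * s + 1).Prime) [CharP k (2 * s + 1)] {a b : ℕ}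
    (hab : s ≤ a + b) :
    X 2 ^ a * disc k ^ b ∈ LinearMap.range (delta k 3 ^ (2 * s)) := by
  have hs : 0 < s := by
    rcases Nat.eq_zero_or_pos s with rfl | h
    · exact absurd hp (by norm_num)
    · exact h
  have hlt : ∀ b < s, X 2 ^ (s - b) * disc k ^ b ∈ LinearMap.range (delta k 3 ^ (2 * s)) := by
    intro b hb
    obtain ⟨u, hu, hT⟩ := exists_trace_eq (k := k) hp hb
    refine ⟨u⁻¹ • (2 * X 0) ^ (s + b), ?_⟩
    rw [map_smul, hT, inv_smul_eq_iff₀ hu, smul_eq_C_mul]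
  have hz : X 2 ^ (2 * s) ∈ LinearMap.range (delta k 3 ^ (2 * s)) := by
    have := mul_mem_range_delta_pow (g := (X 2 : MvPolynomial (Fin 3) k) ^ s)
      (by rw [map_pow, sigmaHom_X_two]) (hlt 0 hs)
    rwa [pow_zero, mul_one, Nat.sub_zero, ← pow_add, ← two_mul] at this
  have hD : disc k ^ s ∈ LinearMap.range (delta k 3 ^ (2 * s)) := by
    obtain ⟨t, rfl⟩ := Nat.exists_eq_add_of_lt hs
    rw [zero_add] at *
    obtain ⟨u, hu, hT⟩ := exists_trace_eq (k := k) hp (Nat.lt_succ_self t)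
    have hrec := trace_recursion (k := k) hp (e := t + 1 + t) (by omega)
    have h1 : ((t + 1 + t + 1 : ℕ) : k) ≠ 0 := by
      rw [Ne, CharP.cast_eq_zero_iff k (2 * (t + 1) + 1)]
      exact Nat.not_dvd_of_pos_of_lt (by omega) (by omega)
    rw [if_pos (by omega), Nat.add_sub_cancel, hT, natCast_eq_C, natCast_eq_C,
      Nat.add_sub_cancel_left] at hrec
    have hw := mul_ne_zero h1 hu
    have key : (((t + 1 + t + 1 : ℕ) : k) * u) • disc k ^ (t + 1) =
        (2 : k) • X 2 ^ (2 * (t + 1)) - ((4 * (t + 1 + t) + 6 : ℕ) : k) •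
          (delta k 3 ^ (2 * (t + 1))) ((2 * X 0) ^ (t + 1 + t + 1)) := by
      refine mul_left_cancel₀ (X_ne_zero (2 : Fin 3)) ?_
      simp only [smul_eq_C_mul, C_mul]
      have h2 : C (σ := Fin 3) (2 : k) = 2 := map_ofNat C 2
      rw [h2]
      linear_combination hrec
    have := Submodule.sub_mem _ (Submodule.smul_mem _ (2 : k) hz)
      (Submodule.smul_mem _ ((4 * (t + 1 + t) + 6 : ℕ) : k)
        (LinearMap.mem_range_self (delta k 3 ^ (2 * (t + 1))) ((2 * X 0) ^ (t + 1 + t + 1))))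
    rw [← key] at this
    exact (Submodule.smul_mem_iff _ hw).1 this
  rcases lt_or_ge b s with hb | hb
  · have := mul_mem_range_delta_pow (g := (X 2 : MvPolynomial (Fin 3) k) ^ (a + b - s))
      (by rw [map_pow, sigmaHom_X_two]) (hlt b hb)
    rwa [← mul_assoc, ← pow_add, show a + b - s + (s - b) = a by omega] at this
  · have := mul_mem_range_delta_pow (g := X 2 ^ a * disc k ^ (b - s))
      (by simp only [map_mul, map_pow, sigmaHom_X_two, sigmaHom_disc]) hD
    rwa [mul_assoc, ← pow_add, Nat.sub_add_cancel hb] at this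

lemma isHomogeneous_delta_pow {m d : ℕ} {f : MvPolynomial (Fin m) k} (hf : f.IsHomogeneous d)
    (j : ℕ) : ((delta k m ^ j) f).IsHomogeneous d := by
  induction j with
  | zero => exact hf
  | succ j ih => rw [pow_succ', Module.End.mul_apply]; exact isHomogeneous_delta ih

lemma isHomogeneous_two_mul_X (i : Fin 3) : (2 * X i : MvPolynomial (Fin 3) k).IsHomogeneous 1 := by
  have := (isHomogeneous_C (Fin 3) (2 : k)).mul (isHomogeneous_X k i)
  rwa [zero_add, map_ofNat] at this

/-- The trace of `(2 x_1)^(p-1) x_2`. -/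
noncomputable def traceInvariant (k : Type*) [Field k] (p : ℕ) : MvPolynomial (Fin 3) k :=
  (delta k 3 ^ (p - 1)) ((2 * X 0) ^ (p - 1) * X 1)

/-- The norm of `2 x_1`. -/
noncomputable def normInvariant (k : Type*) [Field k] (p : ℕ) : MvPolynomial (Fin 3) k :=
  ∏ i ∈ Finset.range p, (sigmaHom k 3 ^ i) (2 * X 0)

lemma isHomogeneous_disc : (disc k).IsHomogeneous 2 := by
  have h1 := ((isHomogeneous_two_mul_X (k := k) 1).sub (isHomogeneous_X k 2)).pow 2
  have h2 := ((isHomogeneous_C (Fin 3) (8 : k)).mul (isHomogeneous_X k 0)).mul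
    (isHomogeneous_X k (2 : Fin 3))
  rw [map_ofNat] at h2
  exact h1.sub h2

lemma isHomogeneous_traceInvariant {p : ℕ} (hp : p.Prime) :
    (traceInvariant k p).IsHomogeneous p := by
  have := ((isHomogeneous_two_mul_X (k := k) 0).pow (p - 1)).mul (isHomogeneous_X k 1)
  rw [one_mul, Nat.sub_add_cancel hp.one_le] at this
  exact isHomogeneous_delta_pow this _

lemma isHomogeneous_normInvariant (p : ℕ) : (normInvariant k p).IsHomogeneous p := by
  have := IsHomogeneous.prod (Finset.range p) (fun i => (sigmaHom k 3 ^ i) (2 * X 0)) (fun _ => 1)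
    fun i _ => isHomogeneous_sigmaHom_pow (isHomogeneous_two_mul_X 0) i
  rwa [Finset.sum_const, Finset.card_range, smul_eq_mul, mul_one] at this

lemma sigmaHom_traceInvariant {p : ℕ} (hp : p.Prime) (hodd : Odd p) [CharP k p] :
    sigmaHom k 3 (traceInvariant k p) = traceInvariant k p := by
  rw [← mem_ker_delta, LinearMap.mem_ker, traceInvariant, ← Module.End.mul_apply, ← pow_succ',
    Nat.sub_add_cancel hp.one_le, delta_pow_prime hp hodd, LinearMap.zero_apply]

lemma sigmaHom_normInvariant {p : ℕ} (hp : p.Prime) (hodd : Odd p) [CharP k p] :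
    sigmaHom k 3 (normInvariant k p) = normInvariant k p := by
  obtain ⟨q, rfl⟩ := Nat.exists_eq_succ_of_ne_zero hp.ne_zero
  rw [normInvariant, map_prod]
  simp_rw [← sigmaHom_pow_succ_apply]
  rw [Finset.prod_range_succ, ← Nat.succ_eq_add_one, sigmaHom_pow_prime hp hodd,
    Finset.prod_range_succ']
  rfl

lemma X_two_dvd_traceInvariant_sub {p : ℕ} (hp : p.Prime) [CharP k p] :
    X 2 ∣ traceInvariant k p - C (-2 ^ (p - 1)) * X 1 ^ p := by
  set P : Polynomial (MvPolynomial (Fin 3) k) :=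
    Polynomial.C (2 * X 1) * Polynomial.X + Polynomial.C (2 * X 0)
  have hP : P.natDegree ≤ 1 := Polynomial.natDegree_linear_le
  have hdeg : (P ^ (p - 1)).natDegree ≤ p - 1 := by
    simpa using Polynomial.natDegree_pow_le_of_le (p - 1) hP
  have hsum := Polynomial.sum_eval_natCast hp (F := P ^ (p - 1)) (by omega)
  have hc : (P ^ (p - 1)).coeff (p - 1) = (2 * X 1) ^ (p - 1) := by
    have := Polynomial.coeff_pow_of_natDegree_le (m := p - 1) hP
    simpa [P, Polynomial.coeff_C] using this
  have h2 := hp.two_le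
  rw [hc, Polynomial.coeff_eq_zero_of_natDegree_lt (by omega), add_zero] at hsum
  have hy : C (-2 ^ (p - 1)) * X 1 ^ p =
      ∑ i ∈ Finset.range p, (P ^ (p - 1)).eval (i : MvPolynomial (Fin 3) k) * X 1 := by
    rw [← Finset.sum_mul, hsum]
    conv_lhs => rw [← Nat.sub_add_cancel hp.one_le, pow_succ]
    simp only [map_neg, map_pow, map_ofNat, Nat.add_sub_cancel]
    ring
  rw [hy, traceInvariant, delta_pow_prime_sub_one hp, ← Finset.sum_sub_distrib]
  refine Finset.dvd_sum fun i _ => ?_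
  rw [map_mul, map_pow, two_mul_sigmaHom_pow_X_zero, sigmaHom_pow_X_one, Polynomial.eval_pow]
  set A := 2 * X 0 + (i : MvPolynomial (Fin 3) k) * (2 * X 1 - X 2) +
    (i : MvPolynomial (Fin 3) k) ^ 2 * X 2
  have hA : X 2 ∣ A ^ (p - 1) - P.eval (i : MvPolynomial (Fin 3) k) ^ (p - 1) := by
    refine Dvd.dvd.trans ⟨(i : MvPolynomial (Fin 3) k) ^ 2 - i, ?_⟩ (sub_dvd_pow_sub_pow _ _ _)
    simp [P, A]
    ring
  have : A ^ (p - 1) * (X 1 + (i : MvPolynomial (Fin 3) k) * X 2) -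
      P.eval (i : MvPolynomial (Fin 3) k) ^ (p - 1) * X 1 =
      (A ^ (p - 1) - P.eval (i : MvPolynomial (Fin 3) k) ^ (p - 1)) * X 1 +
        X 2 * (A ^ (p - 1) * (i : MvPolynomial (Fin 3) k)) := by ring
  rw [this]
  exact dvd_add (hA.mul_right _) (dvd_mul_right _ _)

end Orbit

section LeadingMonomials

/-- The exponent transformation underlying `trailingOrder`. -/
noncomputable def trailingExponent : (Fin 3 →₀ ℕ) →+ Lex (Fin 3 →₀ ℕ) where
  toFun ν := toLex (Finsupp.equivFunOnFinite.symm ![ν 0 + ν 1, ν 0, ν 2])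
  map_zero' := congrArg toLex (Finsupp.ext fun i => by fin_cases i <;> rfl)
  map_add' ν μ := congrArg toLex (a₂ := Finsupp.equivFunOnFinite.symm ![ν 0 + ν 1, ν 0, ν 2] +
    Finsupp.equivFunOnFinite.symm ![μ 0 + μ 1, μ 0, μ 2]) (Finsupp.ext fun i => by
      fin_cases i
      · exact add_add_add_comm _ _ _ _
      · rfl
      · rfl)

lemma trailingExponent_zero (ν : Fin 3 →₀ ℕ) : ofLex (trailingExponent ν) 0 = ν 0 + ν 1 := rfl

lemma trailingExponent_one (ν : Fin 3 →₀ ℕ) : ofLex (trailingExponent ν) 1 = ν 0 := rfl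

lemma trailingExponent_two (ν : Fin 3 →₀ ℕ) : ofLex (trailingExponent ν) 2 = ν 2 := rfl

lemma trailingExponent_injective : Function.Injective trailingExponent := by
  intro ν μ h
  have h0 := congrArg (fun x : Lex (Fin 3 →₀ ℕ) => ofLex x 0) h
  have h1 := congrArg (fun x : Lex (Fin 3 →₀ ℕ) => ofLex x 1) h
  have h2 := congrArg (fun x : Lex (Fin 3 →₀ ℕ) => ofLex x 2) h
  simp only [trailingExponent_zero, trailingExponent_one, trailingExponent_two] at h0 h1 h2
  ext i
  fin_cases i
  · exact h1
  · change ν 1 = μ 1; omega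
  · exact h2

lemma trailingExponent_monotone : Monotone trailingExponent := by
  intro ν μ h
  refine Finsupp.toLex_monotone fun i => ?_
  fin_cases i
  · exact add_le_add (h 0) (h 1)
  · exact h 0
  · exact h 2

/-- `trailingExponent` as an equivalence onto its image. -/
noncomputable def trailingEquiv : (Fin 3 →₀ ℕ) ≃+ AddMonoidHom.mrange trailingExponent :=
  AddEquiv.ofBijective trailingExponent.mrangeRestrict
    ⟨fun _ _ h => trailingExponent_injective (congrArg Subtype.val h),
      trailingExponent.mrangeRestrict_surjective⟩

/-- A monomial order on three variables that agrees with the graded reverse lexicographic order on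
monomials of equal degree. -/
noncomputable def trailingOrder : MonomialOrder (Fin 3) where
  syn := AddMonoidHom.mrange trailingExponent
  toSyn := trailingEquiv
  toSyn_monotone _ _ h := trailingExponent_monotone h

lemma trailingOrder_le_iff {ν μ : Fin 3 →₀ ℕ} :
    trailingOrder.toSyn ν ≤ trailingOrder.toSyn μ ↔ trailingExponent ν ≤ trailingExponent μ :=
  Iff.rfl

lemma MonomialOrder.degree_eq_of_forall_le {σ R : Type*} [CommSemiring R] (m : MonomialOrder σ)
    {f : MvPolynomial σ R} {d : σ →₀ ℕ} (hd : f.coeff d ≠ 0)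
    (h : ∀ ν ∈ f.support, m.toSyn ν ≤ m.toSyn d) : m.degree f = d :=
  m.toSyn.injective (le_antisymm (m.degree_le_iff.2 h) (m.le_degree (mem_support_iff.2 hd)))

variable {k : Type*} [Field k]

lemma degree_eq_of_mem_support {f : MvPolynomial (Fin 3) k} {n : ℕ} (hf : f.IsHomogeneous n)
    {ν : Fin 3 →₀ ℕ} (hν : f.coeff ν ≠ 0) : ν 0 + ν 1 + ν 2 = n := by
  have := hf hν
  rw [Finsupp.weight_apply, Finsupp.sum_fintype _ _ (by simp), Fin.sum_univ_three] at this
  simpa using this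

lemma trailingOrder_degree_of_coeff_X_zero {f : MvPolynomial (Fin 3) k} {n : ℕ}
    (hf : f.IsHomogeneous n) (hc : f.coeff (Finsupp.single 0 n) ≠ 0) :
    trailingOrder.degree f = Finsupp.single 0 n := by
  refine trailingOrder.degree_eq_of_forall_le hc fun ν hν => ?_
  have hd := degree_eq_of_mem_support hf (mem_support_iff.1 hν)
  rw [trailingOrder_le_iff]
  by_cases h : ν 0 = n
  · refine le_of_eq (congrArg _ ?_)
    ext i
    fin_cases i
    · simpa using h
    · change ν 1 = _; simp; omega
    · change ν 2 = _; simp; omega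
  · refine le_of_lt ?_
    by_cases h' : ν 0 + ν 1 = n
    · refine Finsupp.Lex.lt_iff.2 ⟨1, fun j hj => ?_, ?_⟩
      · obtain rfl : j = 0 := by omega
        simp [trailingExponent_zero, h']
      · simp [trailingExponent_one]; omega
    · refine Finsupp.Lex.lt_iff.2 ⟨0, fun j hj => absurd hj (Fin.not_lt_zero j), ?_⟩
      simp [trailingExponent_zero]; omega

lemma trailingOrder_degree_of_X_two_dvd {f : MvPolynomial (Fin 3) k} {n : ℕ}
    (hf : f.IsHomogeneous n) {c : k} (hc : c ≠ 0) (h : X 2 ∣ f - C c * X 1 ^ n) :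
    trailingOrder.degree f = Finsupp.single 1 n := by
  classical
  have hcoeff : ∀ ν : Fin 3 →₀ ℕ, ν 2 = 0 →
      f.coeff ν = if Finsupp.single 1 n = ν then c else 0 := by
    intro ν hν
    obtain ⟨g, hg⟩ := h
    rw [← sub_add_cancel f (C c * X 1 ^ n), hg, coeff_add, coeff_X_mul', if_neg (by simpa using hν),
      zero_add, coeff_C_mul, coeff_X_pow]
    simp
  refine trailingOrder.degree_eq_of_forall_le (by rw [hcoeff _ (by simp), if_pos rfl]; exact hc)
    fun ν hν => ?_
  have hd := degree_eq_of_mem_support hf (mem_support_iff.1 hν)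
  rw [trailingOrder_le_iff]
  by_cases h2 : ν 2 = 0
  · rw [mem_support_iff, hcoeff ν h2, ne_eq, ite_eq_right_iff, Classical.not_imp] at hν
    rw [hν.1]
  · refine le_of_lt (Finsupp.Lex.lt_iff.2 ⟨0, fun j hj => absurd hj (Fin.not_lt_zero j), ?_⟩)
    simp [trailingExponent_zero]; omega

lemma MonomialOrder.linearIndependent_of_degree_injective {σ ι : Type*} (m : MonomialOrder σ)
    {v : ι → MvPolynomial σ k} (hv : ∀ i, v i ≠ 0)
    (hinj : Function.Injective fun i => m.degree (v i)) : LinearIndependent k v := by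
  classical
  rw [linearIndependent_iff']
  intro s
  induction s using Finset.induction_on_max_value (fun i => m.toSyn (m.degree (v i))) with
  | empty => simp
  | insert a s ha hmax ih =>
    intro g hg
    have hlt : ∀ i ∈ s, m.toSyn (m.degree (v i)) < m.toSyn (m.degree (v a)) := fun i hi =>
      (hmax i hi).lt_of_ne fun h => ha (hinj (m.toSyn.injective h) ▸ hi)
    have hga : g a = 0 := by
      have h := congrArg (coeff (m.degree (v a))) hg
      rw [Finset.sum_insert ha, coeff_add, coeff_sum, Finset.sum_eq_zero fun i hi => by
        rw [coeff_smul, m.coeff_eq_zero_of_lt (hlt i hi), smul_zero], add_zero, coeff_smul,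
        coeff_zero, smul_eq_mul] at h
      exact (mul_eq_zero.1 h).resolve_right (m.coeff_degree_ne_zero_iff.2 (hv a))
    rw [Finset.sum_insert ha, hga, zero_smul, zero_add] at hg
    intro i hi
    rcases Finset.mem_insert.1 hi with rfl | hi
    · exact hga
    · exact ih g hg i hi

end LeadingMonomials

section LowerBound

variable {k : Type*} [Field k]

lemma two_ne_zero_of_odd {p : ℕ} (hodd : Odd p) [CharP k p] (hp : p.Prime) : (2 : k) ≠ 0 := by
  have : ((2 : ℕ) : k) ≠ 0 := by
    rw [Ne, CharP.cast_eq_zero_iff k p, Nat.prime_dvd_prime_iff_eq hp Nat.prime_two]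
    rintro rfl
    exact absurd hodd (by decide)
  exact_mod_cast this

lemma trailingOrder_degree_disc (h2 : (2 : k) ≠ 0) :
    trailingOrder.degree (disc k) = Finsupp.single 1 2 := by
  refine trailingOrder_degree_of_X_two_dvd isHomogeneous_disc (pow_ne_zero 2 h2)
    ⟨X 2 - 4 * X 1 - 8 * X 0, ?_⟩
  simp only [disc, map_pow, map_ofNat]
  ring

lemma trailingOrder_degree_traceInvariant {p : ℕ} (hp : p.Prime) [CharP k p] (h2 : (2 : k) ≠ 0) :
    trailingOrder.degree (traceInvariant k p) = Finsupp.single 1 p :=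
  trailingOrder_degree_of_X_two_dvd (isHomogeneous_traceInvariant hp)
    (neg_ne_zero.2 (pow_ne_zero _ h2)) (X_two_dvd_traceInvariant_sub hp)

lemma coeff_sigmaHom_pow_two_mul_X_zero (i : ℕ) :
    ((sigmaHom k 3 ^ i) (2 * X 0)).coeff (Finsupp.single 0 1) = 2 := by
  classical
  have h : 2 * X 0 + (i : MvPolynomial (Fin 3) k) * (2 * X 1 - X 2) +
      (i : MvPolynomial (Fin 3) k) ^ 2 * X 2 =
      C 2 * X 0 + C ((i : k) * 2) * X 1 + C ((i : k) ^ 2 - i) * X 2 := by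
    simp only [map_mul, map_sub, map_pow, map_natCast, map_ofNat]
    ring
  rw [two_mul_sigmaHom_pow_X_zero, h]
  simp only [coeff_add, coeff_C_mul, coeff_X]
  simp [Finsupp.single_left_inj]

lemma normInvariant_factor_ne_zero (h2 : (2 : k) ≠ 0) (i : ℕ) :
    (sigmaHom k 3 ^ i) (2 * X 0) ≠ 0 := fun h => by
  have := coeff_sigmaHom_pow_two_mul_X_zero (k := k) i
  rw [h, coeff_zero] at this
  exact h2 this.symm

lemma trailingOrder_degree_normInvariant (p : ℕ) (h2 : (2 : k) ≠ 0) :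
    trailingOrder.degree (normInvariant k p) = Finsupp.single 0 p := by
  rw [normInvariant, trailingOrder.degree_prod fun i _ => normInvariant_factor_ne_zero h2 i,
    Finset.sum_congr rfl fun i _ => trailingOrder_degree_of_coeff_X_zero
      (isHomogeneous_sigmaHom_pow (isHomogeneous_two_mul_X 0) i)
      (by rw [coeff_sigmaHom_pow_two_mul_X_zero]; exact h2)]
  simp

/-- The products `x_3^a D^b E^ε N^c` of the basic invariants, indexed by `(ε, a, b, c)`. -/
noncomputable def invariantMonomial (k : Type*) [Field k] (p : ℕ) (x : Fin 2 × ℕ × ℕ × ℕ) :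
    MvPolynomial (Fin 3) k :=
  X 2 ^ x.2.1 * disc k ^ x.2.2.1 * traceInvariant k p ^ (x.1 : ℕ) * normInvariant k p ^ x.2.2.2

lemma sigmaHom_invariantMonomial {p : ℕ} (hp : p.Prime) (hodd : Odd p) [CharP k p]
    (x : Fin 2 × ℕ × ℕ × ℕ) :
    sigmaHom k 3 (invariantMonomial k p x) = invariantMonomial k p x := by
  simp only [invariantMonomial, map_mul, map_pow, sigmaHom_X_two, sigmaHom_disc,
    sigmaHom_traceInvariant hp hodd, sigmaHom_normInvariant hp hodd]

lemma isHomogeneous_invariantMonomial {p : ℕ} (hp : p.Prime) (x : Fin 2 × ℕ × ℕ × ℕ) :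
    (invariantMonomial k p x).IsHomogeneous
      (x.2.1 + 2 * x.2.2.1 + p * (x.1 : ℕ) + p * x.2.2.2) := by
  have := ((((isHomogeneous_X k 2).pow x.2.1).mul (isHomogeneous_disc.pow x.2.2.1)).mul
    ((isHomogeneous_traceInvariant hp).pow (x.1 : ℕ))).mul
      ((isHomogeneous_normInvariant p).pow x.2.2.2)
  rwa [one_mul] at this

lemma linearIndependent_invariantMonomial {p : ℕ} (hp : p.Prime) (hodd : Odd p) [CharP k p] :
    LinearIndependent k (invariantMonomial k p) := by
  have h2 := two_ne_zero_of_odd (k := k) hodd hp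
  have hdisc : disc k ≠ 0 := trailingOrder.ne_zero_of_degree_ne_zero (by
    rw [trailingOrder_degree_disc h2]; simp)
  have htrace : traceInvariant k p ≠ 0 := trailingOrder.ne_zero_of_degree_ne_zero (by
    rw [trailingOrder_degree_traceInvariant hp h2]; simp [hp.ne_zero])
  have hnorm : normInvariant k p ≠ 0 :=
    Finset.prod_ne_zero_iff.2 fun i _ => normInvariant_factor_ne_zero h2 i
  have hX : (X 2 : MvPolynomial (Fin 3) k) ≠ 0 := X_ne_zero 2
  have hdeg : ∀ x, trailingOrder.degree (invariantMonomial k p x) =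
      x.2.1 • Finsupp.single 2 1 + x.2.2.1 • Finsupp.single 1 2 +
        (x.1 : ℕ) • Finsupp.single 1 p + x.2.2.2 • Finsupp.single 0 p := fun x => by
    rw [invariantMonomial, trailingOrder.degree_mul, trailingOrder.degree_mul,
      trailingOrder.degree_mul, trailingOrder.degree_pow, trailingOrder.degree_pow,
      trailingOrder.degree_pow, trailingOrder.degree_pow, trailingOrder.degree_X,
      trailingOrder_degree_disc h2, trailingOrder_degree_traceInvariant hp h2,
      trailingOrder_degree_normInvariant p h2]
    all_goals simp [hdisc, htrace, hnorm]
  refine trailingOrder.linearIndependent_of_degree_injective (fun x => by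
    simp [invariantMonomial, hdisc, htrace, hnorm]) ?_
  rintro ⟨ε, a, b, c⟩ ⟨ε', a', b', c'⟩ h
  simp only [hdeg] at h
  have e0 := DFunLike.congr_fun h 0
  have e1 := DFunLike.congr_fun h 1
  have e2 := DFunLike.congr_fun h 2
  simp [hp.ne_zero] at e0 e1 e2
  obtain ⟨s, rfl⟩ := hodd
  have hε : ε = ε' := by
    fin_cases ε <;> fin_cases ε' <;> simp at e1 ⊢ <;> omega
  subst hε e2 e0
  simp at e1
  subst e1
  rfl

/-- The submodule of degree-`d` elements of `k[V_3]^G ∩ im Δ^j`. -/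
noncomputable abbrev invariantImage (k : Type*) [Field k] (j d : ℕ) :
    Submodule k (MvPolynomial (Fin 3) k) :=
  LinearMap.range (delta k 3 ^ j) ⊓ LinearMap.ker (delta k 3) ⊓ homogeneousSubmodule (Fin 3) k d

/-- Exponents `(ε, a, b, c)` of invariant monomials lying in the image of a power of `Δ`. -/
def imageExponent (s l : ℕ) : (ℕ × ℕ × ℕ) ⊕ (ℕ × ℕ × ℕ) → Fin 2 × ℕ × ℕ × ℕ
  | .inl (a, b, c) => (0, a + l, b, c)
  | .inr (a, b, c) =>
    if a < l then (0, l - 1 - a, b + (s + 1 - l + a), c) else (1, a - l, b, c)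

lemma imageExponent_injective (s l : ℕ) : Function.Injective (imageExponent s l) := by
  rintro (⟨a, b, c⟩ | ⟨a, b, c⟩) (⟨a', b', c'⟩ | ⟨a', b', c'⟩) h <;>
    simp only [imageExponent] at h <;> (try split_ifs at h) <;>
    simp only [Prod.mk.injEq, Sum.inl.injEq, Sum.inr.injEq, reduceCtorEq] at h ⊢ <;>
    omega

lemma invariantMonomial_imageExponent_inl_mem {s j : ℕ} (hp : (2 * s + 1).Prime)
    [CharP k (2 * s + 1)] (hj : j < 2 * s + 1) (x : ℕ × ℕ × ℕ) :
    invariantMonomial k (2 * s + 1) (imageExponent s ((j + 1) / 2) (.inl x)) ∈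
      LinearMap.range (delta k 3 ^ j) := by
  have hodd : Odd (2 * s + 1) := odd_two_mul_add_one s
  obtain ⟨a, b, c⟩ := x
  have := mul_mem_range_delta_pow (sigmaHom_invariantMonomial (k := k) hp hodd (0, a, b, c))
    (range_delta_pow_anti (show j ≤ 2 * ((j + 1) / 2) by omega)
      (X_two_pow_mem_range hp (show 2 * ((j + 1) / 2) < 2 * s + 1 by omega)))
  convert this using 1
  simp only [invariantMonomial, imageExponent, pow_add]
  ring

lemma invariantMonomial_imageExponent_inr_mem {s l : ℕ} (hp : (2 * s + 1).Prime)
    [CharP k (2 * s + 1)] (hl : l ≤ s) (x : ℕ × ℕ × ℕ) :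
    invariantMonomial k (2 * s + 1) (imageExponent s l (.inr x)) ∈
      LinearMap.range (delta k 3 ^ (2 * s)) := by
  have hodd : Odd (2 * s + 1) := odd_two_mul_add_one s
  obtain ⟨a, b, c⟩ := x
  simp only [imageExponent]
  split_ifs with h
  · have := mul_mem_range_delta_pow (sigmaHom_invariantMonomial (k := k) hp hodd (0, 0, 0, c))
      (X_two_pow_mul_disc_pow_mem hp (show s ≤ l - 1 - a + (b + (s + 1 - l + a)) by omega))
    convert this using 1
    simp [invariantMonomial, mul_comm]
  · have := mul_mem_range_delta_pow (sigmaHom_invariantMonomial (k := k) hp hodd (0, a - l, b, c))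
      (LinearMap.mem_range_self (delta k 3 ^ (2 * s)) ((2 * X 0) ^ (2 * s) * X 1))
    convert this using 1
    simp [invariantMonomial, traceInvariant]
    ring

/-- The triples of exponents giving degree `d`, with weights `1, 2, p` and a degree shift `m`. -/
abbrev Exponents (p m d : ℕ) : Type :=
  {x : ℕ × ℕ × ℕ // x.1 + 2 * x.2.1 + p * x.2.2 + m = d}

lemma card_le_finrank_invariantImage {s j : ℕ} (hp : (2 * s + 1).Prime) [CharP k (2 * s + 1)]
    (hj : j < 2 * s + 1) (d : ℕ) :
    Nat.card (Exponents (2 * s + 1) ((j + 1) / 2) d ⊕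
        Exponents (2 * s + 1) (2 * s + 1 - (j + 1) / 2) d) ≤
      Module.finrank k (invariantImage k j d) := by
  have hodd : Odd (2 * s + 1) := odd_two_mul_add_one s
  set l := (j + 1) / 2 with hl
  have hls : l ≤ s := by omega
  let φ : Exponents (2 * s + 1) l d ⊕ Exponents (2 * s + 1) (2 * s + 1 - l) d →
    (ℕ × ℕ × ℕ) ⊕ (ℕ × ℕ × ℕ) := Sum.map Subtype.val Subtype.val
  have hφ : Function.Injective φ := Subtype.val_injective.sumMap Subtype.val_injective
  have hmem : ∀ i, invariantMonomial k (2 * s + 1) (imageExponent s l (φ i)) ∈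
      invariantImage k j d := by
    intro i
    refine ⟨⟨?_, mem_ker_delta.2 (sigmaHom_invariantMonomial hp hodd _)⟩, ?_⟩
    · rcases i with ⟨x, hx⟩ | ⟨x, hx⟩
      · exact invariantMonomial_imageExponent_inl_mem hp hj x
      · exact range_delta_pow_anti (by omega) (invariantMonomial_imageExponent_inr_mem hp hls x)
    · have hh := isHomogeneous_invariantMonomial (k := k) hp (imageExponent s l (φ i))
      rw [SetLike.mem_coe, mem_homogeneousSubmodule]
      convert hh using 1
      rcases i with ⟨⟨a, b, c⟩, hx⟩ | ⟨⟨a, b, c⟩, hx⟩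
      · simp only [φ, Sum.map_inl, imageExponent]
        simp only at hx
        simp
        omega
      · simp only [φ, Sum.map_inr, imageExponent]
        simp only at hx
        split_ifs <;> simp <;> omega
  have hli : LinearIndependent k fun i => (⟨_, hmem i⟩ : invariantImage k j d) := by
    refine LinearIndependent.of_comp (invariantImage k j d).subtype ?_
    exact (linearIndependent_invariantMonomial hp hodd).comp (fun i => imageExponent s l (φ i))
      ((imageExponent_injective s l).comp hφ)
  have : Module.Finite k (invariantImage k j d) :=
    Module.Finite.of_injective (Submodule.inclusion (inf_le_right :
      invariantImage k j d ≤ homogeneousSubmodule (Fin 3) k d)) (Submodule.inclusion_injective _)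
  have := hli.finite
  have := Fintype.ofFinite (Exponents (2 * s + 1) l d ⊕ Exponents (2 * s + 1) (2 * s + 1 - l) d)
  rw [Nat.card_eq_fintype_card]
  exact hli.fintype_card_le_finrank

end LowerBound

section Counting

/-- The generating function of the fibre sizes of a weight function. -/
noncomputable def fiberSeries {α : Type*} (w : α → ℕ) : PowerSeries ℤ :=
  PowerSeries.mk fun d => (Nat.card {x // w x = d} : ℤ)

/-- The fibre of `w + m c` splits according to whether `c = 0`. -/
def fiberEquiv {α : Type*} (w : α → ℕ) (m d : ℕ) :
    {x : α × ℕ // w x.1 + m * x.2 = d + m} ≃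
      {x // w x = d + m} ⊕ {x : α × ℕ // w x.1 + m * x.2 = d} where
  toFun x := match x with
    | ⟨(a, 0), h⟩ => .inl ⟨a, by simpa using h⟩
    | ⟨(a, c + 1), h⟩ => .inr ⟨(a, c), by simp only [mul_add] at h ⊢; omega⟩
  invFun
    | .inl a => ⟨(a.1, 0), by simpa using a.2⟩
    | .inr a => ⟨(a.1.1, a.1.2 + 1), by have := a.2; simp only [mul_add]; omega⟩
  left_inv := by rintro ⟨⟨a, _ | c⟩, h⟩ <;> rfl
  right_inv := by rintro (a | a) <;> rfl

/-- The fibre of `w + m c` over a value less than `m`. -/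
def fiberEquivOfLt {α : Type*} (w : α → ℕ) {m d : ℕ} (hd : d < m) :
    {x : α × ℕ // w x.1 + m * x.2 = d} ≃ {x // w x = d} where
  toFun x := ⟨x.1.1, by
    have := x.2
    rcases h : x.1.2 with _ | c
    · rw [h] at this; simpa using this
    · rw [h, mul_add] at this; omega⟩
  invFun a := ⟨(a.1, 0), by simpa using a.2⟩
  left_inv := by
    rintro ⟨⟨a, _ | c⟩, h⟩
    · rfl
    · simp only [mul_add] at h; omega
  right_inv _ := rfl

variable {α : Type*} {w : α → ℕ}

lemma finite_fiber_add_mul (hw : ∀ d, Finite {x // w x = d}) {m : ℕ} (hm : 0 < m) (d : ℕ) :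
    Finite {x : α × ℕ // w x.1 + m * x.2 = d} := by
  induction d using Nat.strong_induction_on with
  | _ d ih =>
    rcases lt_or_ge d m with h | h
    · exact Finite.of_equiv _ (fiberEquivOfLt w h).symm
    · obtain ⟨d, rfl⟩ := Nat.exists_eq_add_of_le' h
      have := ih d (by omega)
      exact Finite.of_equiv _ (fiberEquiv w m d).symm

lemma one_sub_X_pow_mul_fiberSeries (hw : ∀ d, Finite {x // w x = d}) {m : ℕ} (hm : 0 < m) :
    (1 - PowerSeries.X ^ m) * fiberSeries (fun x : α × ℕ => w x.1 + m * x.2) = fiberSeries w := by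
  ext d
  rw [sub_mul, one_mul, map_sub, PowerSeries.coeff_X_pow_mul', fiberSeries, fiberSeries,
    PowerSeries.coeff_mk, PowerSeries.coeff_mk]
  split_ifs with h
  · obtain ⟨d, rfl⟩ := Nat.exists_eq_add_of_le' h
    have := finite_fiber_add_mul hw hm d
    rw [Nat.card_congr (fiberEquiv w m d), Nat.card_sum, Nat.add_sub_cancel, PowerSeries.coeff_mk]
    push_cast
    ring
  · rw [Nat.card_congr (fiberEquivOfLt w (not_le.1 h)), sub_zero, PowerSeries.coeff_mk]

lemma fiberSeries_add (m : ℕ) :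
    fiberSeries (fun x => w x + m) = PowerSeries.X ^ m * fiberSeries w := by
  ext d
  rw [PowerSeries.coeff_X_pow_mul', fiberSeries, fiberSeries, PowerSeries.coeff_mk]
  split_ifs with h
  · rw [PowerSeries.coeff_mk]
    exact congrArg _ (Nat.card_congr (Equiv.subtypeEquivRight fun x => by omega))
  · have : IsEmpty {x // w x + m = d} := ⟨fun x => by have := x.2; omega⟩
    simp

lemma finite_fiber_id (d : ℕ) : Finite {x : ℕ // x = d} := Finite.of_subsingleton

lemma one_sub_X_mul_fiberSeries_id : (1 - PowerSeries.X) * fiberSeries (fun x : ℕ => x) = 1 := by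
  have : fiberSeries (fun x : ℕ => x) = PowerSeries.mk 1 := by
    ext d
    simp [fiberSeries]
  rw [this, mul_comm, PowerSeries.mk_one_mul_one_sub_eq_one]

/-- The generating function of `ℕ³` with weights `1, a, b`. -/
lemma mul_fiberSeries_triple {a b : ℕ} (ha : 0 < a) (hb : 0 < b) :
    (1 - PowerSeries.X) * (1 - PowerSeries.X ^ a) * (1 - PowerSeries.X ^ b) *
      fiberSeries (fun x : ℕ × ℕ × ℕ => x.1 + a * x.2.1 + b * x.2.2) = 1 := by
  have h : fiberSeries (fun x : ℕ × ℕ × ℕ => x.1 + a * x.2.1 + b * x.2.2) =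
      fiberSeries (fun x : (ℕ × ℕ) × ℕ => (x.1.1 + a * x.1.2) + b * x.2) := by
    ext d
    rw [fiberSeries, fiberSeries,
    PowerSeries.coeff_mk, PowerSeries.coeff_mk]
    exact congrArg _ (Nat.card_congr ((Equiv.prodAssoc ℕ ℕ ℕ).symm.subtypeEquiv fun _ => Iff.rfl))
  rw [h, mul_assoc, one_sub_X_pow_mul_fiberSeries (finite_fiber_add_mul finite_fiber_id ha) hb,
    mul_assoc, one_sub_X_pow_mul_fiberSeries finite_fiber_id ha, one_sub_X_mul_fiberSeries_id]

lemma finite_fiber_triple {a b : ℕ} (ha : 0 < a) (hb : 0 < b) (d : ℕ) :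
    Finite {x : ℕ × ℕ × ℕ // x.1 + a * x.2.1 + b * x.2.2 = d} :=
  have := finite_fiber_add_mul (finite_fiber_add_mul finite_fiber_id ha) hb d
  Finite.of_equiv _ ((Equiv.prodAssoc ℕ ℕ ℕ).subtypeEquiv (p := fun x : (ℕ × ℕ) × ℕ =>
    (x.1.1 + a * x.1.2) + b * x.2 = d) fun _ => Iff.rfl)

lemma finite_exponents {p : ℕ} (hp : 0 < p) (m d : ℕ) : Finite (Exponents p m d) :=
  have := finite_fiber_triple two_pos hp (d - m)
  Finite.of_injective (fun x : Exponents p m d =>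
    (⟨x.1, by have := x.2; omega⟩ : {x : ℕ × ℕ × ℕ // x.1 + 2 * x.2.1 + p * x.2.2 = d - m}))
    fun x y h => Subtype.ext (Subtype.mk.inj h)

/-- The generating function of the exponent triples counted with shifts `l` and `p - l`. -/
lemma mul_mk_card_exponents {p : ℕ} (hp : 0 < p) (l : ℕ) :
    (1 - PowerSeries.X) * (1 - PowerSeries.X ^ 2) * (1 - PowerSeries.X ^ p) *
      PowerSeries.mk (fun d => (Nat.card (Exponents p l d ⊕ Exponents p (p - l) d) : ℤ)) =
      PowerSeries.X ^ l + PowerSeries.X ^ (p - l) := by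
  have h : PowerSeries.mk (fun d => (Nat.card (Exponents p l d ⊕ Exponents p (p - l) d) : ℤ)) =
      PowerSeries.X ^ l * fiberSeries (fun x : ℕ × ℕ × ℕ => x.1 + 2 * x.2.1 + p * x.2.2) +
        PowerSeries.X ^ (p - l) *
          fiberSeries (fun x : ℕ × ℕ × ℕ => x.1 + 2 * x.2.1 + p * x.2.2) := by
    rw [← fiberSeries_add, ← fiberSeries_add]
    ext d
    have := finite_exponents hp l d
    have := finite_exponents hp (p - l) d
    rw [PowerSeries.coeff_mk, Nat.card_sum, map_add, fiberSeries, fiberSeries,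
      PowerSeries.coeff_mk, PowerSeries.coeff_mk]
    push_cast
    rfl
  rw [h]
  linear_combination (PowerSeries.X ^ l + PowerSeries.X ^ (p - l)) *
    mul_fiberSeries_triple two_pos hp

lemma one_sub_X_mul_sum_X_pow (r : ℕ) : (1 - PowerSeries.X : PowerSeries ℤ) *
    ∑ j ∈ Finset.range (2 * r + 1), PowerSeries.X ^ ((j + 1) / 2) =
      1 + PowerSeries.X - 2 * PowerSeries.X ^ (r + 1) := by
  induction r with
  | zero => simp; ring
  | succ r ih =>
    rw [show 2 * (r + 1) + 1 = 2 * r + 1 + 1 + 1 by ring, Finset.sum_range_succ,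
      Finset.sum_range_succ, mul_add, mul_add, ih, show (2 * r + 1 + 1) / 2 = r + 1 by omega,
      show (2 * r + 1 + 1 + 1) / 2 = r + 1 by omega]
    ring

lemma one_sub_X_mul_sum_X_pow_sub {p r : ℕ} (hr : r ≤ p) : (1 - PowerSeries.X : PowerSeries ℤ) *
    ∑ j ∈ Finset.range (2 * r + 1), PowerSeries.X ^ (p - (j + 1) / 2) =
      2 * PowerSeries.X ^ (p - r) - PowerSeries.X ^ p - PowerSeries.X ^ (p + 1) := by
  induction r with
  | zero => simp; ring
  | succ r ih =>
    rw [show 2 * (r + 1) + 1 = 2 * r + 1 + 1 + 1 by ring, Finset.sum_range_succ,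
      Finset.sum_range_succ, mul_add, mul_add, ih (by omega),
      show (2 * r + 1 + 1) / 2 = r + 1 by omega,
      show (2 * r + 1 + 1 + 1) / 2 = r + 1 by omega, show p - r = p - (r + 1) + 1 by omega]
    ring

lemma sum_card_exponents (s d : ℕ) :
    ∑ j ∈ Finset.range (2 * s + 1), Nat.card (Exponents (2 * s + 1) ((j + 1) / 2) d ⊕
        Exponents (2 * s + 1) (2 * s + 1 - (j + 1) / 2) d) =
      Nat.card {x : ℕ × ℕ × ℕ // x.1 + 1 * x.2.1 + 1 * x.2.2 = d} := by
  set p := 2 * s + 1 with hp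
  have hp0 : 0 < p := by omega
  have hne : ∀ m : ℕ, 0 < m → (1 - PowerSeries.X ^ m : PowerSeries ℤ) ≠ 0 := fun m hm h => by
    have := congrArg (PowerSeries.coeff 0) h
    simp [hm.ne'] at this
  have h1 : (1 - PowerSeries.X : PowerSeries ℤ) ≠ 0 := by simpa using hne 1 one_pos
  have key : ∑ j ∈ Finset.range p, PowerSeries.mk (fun d => (Nat.card
      (Exponents p ((j + 1) / 2) d ⊕ Exponents p (p - (j + 1) / 2) d) : ℤ)) =
      fiberSeries fun x : ℕ × ℕ × ℕ => x.1 + 1 * x.2.1 + 1 * x.2.2 := by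
    refine mul_left_cancel₀ (mul_ne_zero h1 (mul_ne_zero (mul_ne_zero h1 (hne 2 two_pos))
      (hne p hp0))) ?_
    have hsum : (1 - PowerSeries.X : PowerSeries ℤ) *
        ((1 - PowerSeries.X) * (1 - PowerSeries.X ^ 2) * (1 - PowerSeries.X ^ p) *
          ∑ j ∈ Finset.range p, PowerSeries.mk (fun d => (Nat.card
          (Exponents p ((j + 1) / 2) d ⊕ Exponents p (p - (j + 1) / 2) d) : ℤ))) =
        (1 + PowerSeries.X) * (1 - PowerSeries.X ^ p) := by
      rw [Finset.mul_sum, Finset.sum_congr rfl fun j _ => mul_mk_card_exponents hp0 _,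
        Finset.sum_add_distrib, mul_add]
      have e1 := one_sub_X_mul_sum_X_pow s
      have e2 := one_sub_X_mul_sum_X_pow_sub (p := p) (r := s) (by omega)
      rw [← hp] at e1 e2
      rw [e1, e2, show p - s = s + 1 by omega]
      ring
    have h3 := mul_fiberSeries_triple one_pos one_pos
    rw [pow_one] at h3
    linear_combination hsum - (1 + PowerSeries.X) * (1 - PowerSeries.X ^ p) * h3
  have := congrArg (PowerSeries.coeff d) key
  simp only [map_sum, PowerSeries.coeff_mk, fiberSeries] at this
  exact_mod_cast this

/-- Exponent vectors of degree `d` in three variables as triples. -/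
noncomputable def degreeEquiv (d : ℕ) : {ν : Fin 3 →₀ ℕ | ν.degree = d} ≃
    {x : ℕ × ℕ × ℕ // x.1 + 1 * x.2.1 + 1 * x.2.2 = d} where
  toFun ν := ⟨(ν.1 0, ν.1 1, ν.1 2), by
    have := ν.2
    rw [Set.mem_ofPred_eq, Finsupp.degree_eq_sum, Fin.sum_univ_three] at this
    simpa using this⟩
  invFun x := ⟨Finsupp.equivFunOnFinite.symm ![x.1.1, x.1.2.1, x.1.2.2], by
    rw [Set.mem_ofPred_eq, Finsupp.degree_eq_sum, Fin.sum_univ_three]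
    simpa using x.2⟩
  left_inv ν := by
    ext i
    fin_cases i <;> rfl
  right_inv _ := rfl

lemma finrank_homogeneousSubmodule (k : Type*) [Field k] (d : ℕ) :
    Module.finrank k (homogeneousSubmodule (Fin 3) k d) =
      Nat.card {x : ℕ × ℕ × ℕ // x.1 + 1 * x.2.1 + 1 * x.2.2 = d} := by
  have := finite_fiber_triple one_pos one_pos d
  have hfin : Finite {ν : Fin 3 →₀ ℕ | ν.degree = d} := Finite.of_equiv _ (degreeEquiv d).symm
  have := Fintype.ofFinite {ν : Fin 3 →₀ ℕ | ν.degree = d}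
  rw [homogeneousSubmodule_eq_finsupp_supported,
    (AddMonoidAlgebra.supportedEquivFinsupp _).finrank_eq, Module.finrank_finsupp_self,
    ← Nat.card_eq_fintype_card, Nat.card_congr (degreeEquiv d)]

end Counting

section Equality

variable {k : Type*} [Field k]

lemma finrank_invariantImage {s j : ℕ} (hp : (2 * s + 1).Prime) [CharP k (2 * s + 1)]
    (hj : j < 2 * s + 1) (d : ℕ) :
    Module.finrank k (invariantImage k j d) =
      Nat.card (Exponents (2 * s + 1) ((j + 1) / 2) d ⊕
        Exponents (2 * s + 1) (2 * s + 1 - (j + 1) / 2) d) := by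
  have hsum := (sum_card_exponents s d).trans
    ((finrank_homogeneousSubmodule k d).symm.trans
      (sum_finrank_invariants hp (odd_two_mul_add_one s) d).symm)
  have hle : ∀ i ∈ Finset.range (2 * s + 1), _ := fun i hi =>
    card_le_finrank_invariantImage (k := k) hp (Finset.mem_range.1 hi) d
  exact ((Finset.sum_eq_sum_iff_of_le hle).1 hsum j (Finset.mem_range.2 hj)).symm

end Equality

/-- Let `p` be an odd prime, `2 ≤ n ≤ p`, and `l = n/2` if `n` is even,
`l = (n−1)/2` if `n` is odd.  Then the Hilbert series of
`I_{n−1}^G = k[V_3]^G ∩ im(Δ^{n−1}) = ker Δ ⊓ range(Δ^{n-1})` satisfies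
`(1−t)(1−t^2)(1−t^p)·H(I_{n−1}^G, t) = t^l + t^{p−l}`. -/
theorem statement15 (p : ℕ) (hp : p.Prime) (hodd : Odd p)
    (k : Type*) [Field k] [CharP k p]
    (n : ℕ) (hn : 2 ≤ n) (hnp : n ≤ p) (l : ℕ) (hl : l = n / 2) :
    (1 - PowerSeries.X) * (1 - PowerSeries.X ^ 2) * (1 - PowerSeries.X ^ p) *
      PowerSeries.mk (fun d =>
        (Module.finrank k
          ↥(LinearMap.range (delta k 3 ^ (n - 1)) ⊓ LinearMap.ker (delta k 3) ⊓
            homogeneousSubmodule (Fin 3) k d) : ℤ)) =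
    PowerSeries.X ^ l + (PowerSeries.X : PowerSeries ℤ) ^ (p - l) := by
  obtain ⟨s, rfl⟩ := hodd
  subst hl
  simp_rw [finrank_invariantImage hp (show n - 1 < 2 * s + 1 by omega)]
  rw [show (n - 1 + 1) / 2 = n / 2 by omega]
  exact mul_mk_card_exponents hp.pos _
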